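/- Let β ∈ (−1, 1), μ₊, μ₋ ∈ ℝ, t > 0, x > 0 and y > 0. Then ∫₀^t f⁺(η; y) · h(t − η; x, μ₊) dη = ∫₀^∞ ∫₀^t h(t − τ; (1+β) b + x + y, μ₊) · h(τ; (1−β) b, −μ₋) dτ db. -/

import Mathlib

open MeasureTheory Real Set Filter

/-- The auxiliary density `h(t; x, μ) = |x| / √(2π t³) · exp(−(x + μ t)² / (2t))`. -/
noncomputable def h (t x μ : ℝ) : ℝ :=
  |x| / Real.sqrt (2 * Real.pi * t ^ 3) * Real.exp (-(x + μ * t) ^ 2 / (2 * t))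

/-- `f⁺(s; y) = ∫₀^∞ ∫₀^s h(s − τ; (1+β) b + y, μ₊) · h(τ; (1−β) b, −μ₋) dτ db`. -/
noncomputable def fplus (β μp μm s y : ℝ) : ℝ :=
  ∫ b in Ioi (0 : ℝ), ∫ τ in (0 : ℝ)..s,
    h (s - τ) ((1 + β) * b + y) μp * h τ ((1 - β) * b) (-μm)

lemma h_nonneg (t x μ : ℝ) : 0 ≤ h t x μ := by
  unfold h; positivity

lemma h_of_nonpos {t : ℝ} (ht : t ≤ 0) (x μ : ℝ) : h t x μ = 0 := by
  have : 2 * Real.pi * t ^ 3 ≤ 0 :=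
    mul_nonpos_of_nonneg_of_nonpos (by positivity) (Odd.pow_nonpos (by decide) ht)
  simp [h, Real.sqrt_eq_zero_of_nonpos this]

lemma Measurable.h_comp {α : Type*} [MeasurableSpace α] {f g : α → ℝ} (hf : Measurable f)
    (hg : Measurable g) (μ : ℝ) : Measurable fun a => h (f a) (g a) μ := by
  have habs : Measurable fun a => |g a| := continuous_abs.measurable.comp hg
  unfold h
  fun_prop

/-- The drift enters `h` only through an exponential tilt. -/
lemma h_eq_exp_mul (t x μ : ℝ) : h t x μ = exp (-x * μ - μ ^ 2 * t / 2) * h t x 0 := by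
  rcases le_or_gt t 0 with ht | ht
  · simp [h_of_nonpos ht]
  · unfold h
    rw [mul_left_comm, ← Real.exp_add]
    congr 2
    field_simp
    ring

lemma h_zero_of_pos {t x : ℝ} (ht : 0 < t) (hx : 0 < x) :
    h t x 0 = x / (√(2 * π) * (t * √t)) * exp (-x ^ 2 / (2 * t)) := by
  unfold h
  rw [Real.sqrt_mul (by positivity : 0 ≤ 2 * π), abs_of_pos hx,
    show t ^ 3 = t ^ 2 * t by ring, Real.sqrt_mul (sq_nonneg t), Real.sqrt_sq ht.le]
  simp

/-- The primitive of the Gaussian `exp (-u² / 2)` that vanishes at `0`. -/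
noncomputable def gaussPrimitive (z : ℝ) : ℝ := ∫ u in (0 : ℝ)..z, exp (-(1 / 2) * u ^ 2)

lemma hasDerivAt_gaussPrimitive (z : ℝ) :
    HasDerivAt gaussPrimitive (exp (-(1 / 2) * z ^ 2)) z := by
  have hc : Continuous fun u : ℝ => exp (-(1 / 2) * u ^ 2) := by fun_prop
  exact intervalIntegral.integral_hasDerivAt_right (hc.intervalIntegrable _ _)
    hc.stronglyMeasurable.stronglyMeasurableAtFilter hc.continuousAt

lemma tendsto_gaussPrimitive_atTop : Tendsto gaussPrimitive atTop (nhds (√(2 * π) / 2)) := by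
  have hi : Integrable fun u : ℝ => exp (-(1 / 2) * u ^ 2) :=
    integrable_exp_neg_mul_sq (by norm_num)
  have hl := intervalIntegral_tendsto_integral_Ioi 0 hi.integrableOn tendsto_id
  rw [integral_gaussian_Ioi, show π / (1 / 2) = 2 * π by ring] at hl
  exact hl

lemma gaussPrimitive_neg (z : ℝ) : gaussPrimitive (-z) = -gaussPrimitive z := by
  have := intervalIntegral.integral_comp_neg (a := 0) (b := z)
    (fun u : ℝ => exp (-(1 / 2) * u ^ 2))
  simp only [neg_sq, neg_zero] at this
  rw [gaussPrimitive, gaussPrimitive, this, intervalIntegral.integral_symm]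

lemma tendsto_gaussPrimitive_atBot :
    Tendsto gaussPrimitive atBot (nhds (-(√(2 * π) / 2))) := by
  have := (tendsto_gaussPrimitive_atTop.comp tendsto_neg_atBot_atTop).neg
  refine this.congr fun z => ?_
  simp [gaussPrimitive_neg]

/-- The derivative of `s ↦ (a s + c (T - s)) / √(s (T - s))`. -/
lemma hasDerivAt_ratio {T s : ℝ} (hs : 0 < s) (hsT : s < T) (a c : ℝ) :
    HasDerivAt (fun s => (a * s + c * (T - s)) / (√T * (√s * √(T - s))))
      (T * (a * s - c * (T - s)) / (2 * √T * (s * √s * ((T - s) * √(T - s))))) s := by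
  have hr : 0 < T - s := sub_pos.2 hsT
  have hT : 0 < T := hs.trans hsT
  have h1 : HasDerivAt (fun s => √s) (1 / (2 * √s)) s := Real.hasDerivAt_sqrt hs.ne'
  have h2 : HasDerivAt (fun s => T - s) (-1) s := by
    simpa using (hasDerivAt_id s).const_sub T
  have h3 : HasDerivAt (fun s => √(T - s)) (-1 / (2 * √(T - s))) s := h2.sqrt hr.ne'
  have h4 : HasDerivAt (fun s => a * s + c * (T - s)) (a * 1 + c * (-1)) s :=
    ((hasDerivAt_id s).const_mul a).add (h2.const_mul c)
  have p1 : 0 < √s := Real.sqrt_pos.2 hs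
  have p2 : 0 < √(T - s) := Real.sqrt_pos.2 hr
  have p3 : 0 < √T := Real.sqrt_pos.2 hT
  have hd := h4.div ((h1.mul h3).const_mul √T) (mul_pos p3 (mul_pos p1 p2)).ne'
  refine hd.congr_deriv ?_
  simp only [Pi.mul_apply]
  have e1 : √s ^ 2 = s := Real.sq_sqrt hs.le
  have e2 : √(T - s) ^ 2 = T - s := Real.sq_sqrt hr.le
  have e3 : T = √s ^ 2 + √(T - s) ^ 2 := by rw [e1, e2]; ring
  generalize √T = w at *
  generalize √(T - s) = v at *
  generalize √s = u at *
  subst e1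
  rw [← e2, e3]
  field_simp
  ring

lemma tendsto_inv_sqrt_prod_atTop {T : ℝ} (l : Filter ℝ) (hl : ∀ᶠ s in l, 0 < s ∧ s < T)
    (h0 : Tendsto (fun s => √T * (√s * √(T - s))) l (nhds 0)) :
    Tendsto (fun s => (√T * (√s * √(T - s)))⁻¹) l atTop := by
  refine Tendsto.inv_tendsto_nhdsGT_zero (tendsto_nhdsWithin_iff.2 ⟨h0, ?_⟩)
  filter_upwards [hl] with s hs
  have h1 := Real.sqrt_pos.2 hs.1
  have h2 := Real.sqrt_pos.2 (sub_pos.2 hs.2)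
  have h3 := Real.sqrt_pos.2 (hs.1.trans hs.2)
  exact mul_pos h3 (mul_pos h1 h2)

lemma exp_ratio {T s : ℝ} (hs : 0 < s) (hsT : s < T) (a c : ℝ) :
    exp (-(1 / 2) * ((a * s + c * (T - s)) / (√T * (√s * √(T - s)))) ^ 2)
      = exp ((a - c) ^ 2 / (2 * T)) *
        (exp (-a ^ 2 / (2 * (T - s))) * exp (-c ^ 2 / (2 * s))) := by
  have hr : 0 < T - s := sub_pos.2 hsT
  have hT : 0 < T := hs.trans hsT
  rw [← Real.exp_add, ← Real.exp_add, div_pow, mul_pow, mul_pow, Real.sq_sqrt hs.le,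
    Real.sq_sqrt hr.le, Real.sq_sqrt hT.le]
  congr 1
  field_simp
  ring

/-- A primitive of `s ↦ h (T - s) a 0 * h s c 0` on `(0, T)`. -/
noncomputable def convPrimitive (T a c s : ℝ) : ℝ :=
  (a + c) / (2 * π * (T * √T)) * exp (-(a + c) ^ 2 / (2 * T)) *
      gaussPrimitive ((a * s + -c * (T - s)) / (√T * (√s * √(T - s))))
    + (c - a) / (2 * π * (T * √T)) * exp (-(a - c) ^ 2 / (2 * T)) *
      gaussPrimitive ((a * s + c * (T - s)) / (√T * (√s * √(T - s))))

lemma hasDerivAt_convPrimitive {T s a c : ℝ} (hs : 0 < s) (hsT : s < T) (ha : 0 < a)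
    (hc : 0 < c) :
    HasDerivAt (convPrimitive T a c) (h (T - s) a 0 * h s c 0) s := by
  have hr : 0 < T - s := sub_pos.2 hsT
  have hT : 0 < T := hs.trans hsT
  have d1 := ((hasDerivAt_gaussPrimitive _).comp s (hasDerivAt_ratio hs hsT a (-c))).const_mul
    ((a + c) / (2 * π * (T * √T)) * exp (-(a + c) ^ 2 / (2 * T)))
  have d2 := ((hasDerivAt_gaussPrimitive _).comp s (hasDerivAt_ratio hs hsT a c)).const_mul
    ((c - a) / (2 * π * (T * √T)) * exp (-(a - c) ^ 2 / (2 * T)))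
  refine (d1.add d2).congr_deriv ?_
  rw [exp_ratio hs hsT, exp_ratio hs hsT, h_zero_of_pos hr ha, h_zero_of_pos hs hc]
  have e1 : exp (-(a + c) ^ 2 / (2 * T)) = (exp ((a - -c) ^ 2 / (2 * T)))⁻¹ := by
    rw [← Real.exp_neg]; congr 1; ring
  have e2 : exp (-(a - c) ^ 2 / (2 * T)) = (exp ((a - c) ^ 2 / (2 * T)))⁻¹ := by
    rw [← Real.exp_neg]; congr 1; ring
  have e3 : √(2 * π) ^ 2 = 2 * π := Real.sq_sqrt (by positivity)
  have e4 : √T ^ 2 = T := Real.sq_sqrt hT.le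
  have q1 : 0 < √(2 * π) := by positivity
  have q2 : 0 < √T := Real.sqrt_pos.2 hT
  have q3 : 0 < √s := Real.sqrt_pos.2 hs
  have q4 : 0 < √(T - s) := Real.sqrt_pos.2 hr
  have e5 : exp (-(-c) ^ 2 / (2 * s)) = exp (-c ^ 2 / (2 * s)) := by rw [neg_sq]
  rw [e1, e2, e5]
  have n1 := (Real.exp_pos ((a - -c) ^ 2 / (2 * T))).ne'
  have n2 := (Real.exp_pos ((a - c) ^ 2 / (2 * T))).ne'
  generalize exp ((a - -c) ^ 2 / (2 * T)) = E1 at *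
  generalize exp ((a - c) ^ 2 / (2 * T)) = E2 at *
  generalize exp (-a ^ 2 / (2 * (T - s))) = E3 at *
  generalize exp (-c ^ 2 / (2 * s)) = E4 at *
  have key : ∀ r : ℝ, r = T - s →
      (a + c) * (a * s + c * r) + (c - a) * (a * s - c * r) = 2 * a * c * T := by
    intro r hr; subst hr; ring
  have k := key (T - s) rfl
  generalize √(T - s) = v at *
  generalize T - s = r at *
  generalize √s = u at *
  generalize √(2 * π) = g at *
  generalize √T = w at *
  trans (((a + c) * (a * s + c * r) + (c - a) * (a * s - c * r)) * E3 * E4 /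
    (2 * (2 * π) * w ^ 2 * (s * u * (r * v))))
  · field_simp
    ring
  · rw [k, e4, ← e3]
    field_simp

lemma tendsto_convPrimitive_zero {T a c : ℝ} (hT : 0 < T) (hc : 0 < c) :
    Tendsto (convPrimitive T a c) (nhdsWithin 0 (Ioi 0))
      (nhds ((a + c) / (2 * π * (T * √T)) * exp (-(a + c) ^ 2 / (2 * T)) * (-(√(2 * π) / 2))
        + (c - a) / (2 * π * (T * √T)) * exp (-(a - c) ^ 2 / (2 * T)) * (√(2 * π) / 2))) := by
  have hev : ∀ᶠ s in nhdsWithin (0 : ℝ) (Ioi 0), 0 < s ∧ s < T :=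
    Ioo_mem_nhdsGT hT
  have hinv := tendsto_inv_sqrt_prod_atTop _ hev (by
    have : Continuous fun s => √T * (√s * √(T - s)) := by fun_prop
    simpa using (this.tendsto 0).mono_left nhdsWithin_le_nhds)
  have hnum (k : ℝ) : Tendsto (fun s => a * s + k * (T - s)) (nhdsWithin 0 (Ioi 0))
      (nhds (k * T)) := by
    have : Continuous fun s => a * s + k * (T - s) := by fun_prop
    simpa using (this.tendsto 0).mono_left nhdsWithin_le_nhds
  refine ((tendsto_gaussPrimitive_atBot.comp ?_).const_mul _).add
    ((tendsto_gaussPrimitive_atTop.comp ?_).const_mul _)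
  · exact (hnum (-c)).neg_mul_atTop (by nlinarith) hinv
  · exact (hnum c).pos_mul_atTop (by positivity) hinv

lemma tendsto_convPrimitive_right {T a c : ℝ} (hT : 0 < T) (ha : 0 < a) :
    Tendsto (convPrimitive T a c) (nhdsWithin T (Iio T))
      (nhds ((a + c) / (2 * π * (T * √T)) * exp (-(a + c) ^ 2 / (2 * T)) * (√(2 * π) / 2)
        + (c - a) / (2 * π * (T * √T)) * exp (-(a - c) ^ 2 / (2 * T)) * (√(2 * π) / 2))) := by
  have hev : ∀ᶠ s in nhdsWithin T (Iio T), 0 < s ∧ s < T :=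
    Ioo_mem_nhdsLT hT
  have hinv := tendsto_inv_sqrt_prod_atTop _ hev (by
    have : Continuous fun s => √T * (√s * √(T - s)) := by fun_prop
    simpa using (this.tendsto T).mono_left nhdsWithin_le_nhds)
  have hnum (k : ℝ) : Tendsto (fun s => a * s + k * (T - s)) (nhdsWithin T (Iio T))
      (nhds (a * T)) := by
    have : Continuous fun s => a * s + k * (T - s) := by fun_prop
    simpa using (this.tendsto T).mono_left nhdsWithin_le_nhds
  refine ((tendsto_gaussPrimitive_atTop.comp ?_).const_mul _).add
    ((tendsto_gaussPrimitive_atTop.comp ?_).const_mul _)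
  · exact (hnum (-c)).pos_mul_atTop (by positivity) hinv
  · exact (hnum c).pos_mul_atTop (by positivity) hinv

lemma lintegral_deriv_of_nonneg_of_tendsto {f f' : ℝ → ℝ} {a b la lb : ℝ} (hab : a < b)
    (hderiv : ∀ x ∈ Ioo a b, HasDerivAt f (f' x) x) (hpos : ∀ x ∈ Ioo a b, 0 ≤ f' x)
    (ha : Tendsto f (nhdsWithin a (Ioi a)) (nhds la))
    (hb : Tendsto f (nhdsWithin b (Iio b)) (nhds lb)) :
    ∫⁻ x in Ioo a b, ENNReal.ofReal (f' x) = ENNReal.ofReal (lb - la) := by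
  have hcont : ContinuousOn f (Ioo a b) := fun x hx => (hderiv x hx).continuousAt.continuousWithinAt
  have hext : ∀ x ∈ Ioo a b, HasDerivAt (extendFrom (Ioo a b) f) (f' x) x := fun x hx => by
    refine (hderiv x hx).congr_of_eventuallyEq ?_
    filter_upwards [isOpen_Ioo.mem_nhds hx] with y hy
    exact extendFrom_eq (subset_closure hy) (hcont y hy)
  have hint : IntegrableOn f' (Ioc a b) := intervalIntegral.integrableOn_deriv_of_nonneg
    (continuousOn_Icc_extendFrom_Ioo hcont ha hb) hext hpos
  have hval := intervalIntegral.integral_eq_sub_of_hasDerivAt_of_tendsto hab hderiv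
    ((intervalIntegrable_iff_integrableOn_Ioc_of_le hab.le).2 hint) ha hb
  rw [← hval, intervalIntegral.integral_of_le hab.le, integral_Ioc_eq_integral_Ioo,
    ofReal_integral_eq_lintegral_ofReal (hint.mono_set Ioo_subset_Ioc_self)]
  exact (ae_restrict_iff' measurableSet_Ioo).2 (Eventually.of_forall hpos)

lemma lintegral_eq_setLIntegral_Ioo {f : ℝ → ENNReal} {a b : ℝ}
    (hf : ∀ x, x ∉ Ioo a b → f x = 0) : ∫⁻ x, f x = ∫⁻ x in Ioo a b, f x := by
  rw [← lintegral_indicator measurableSet_Ioo]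
  congr 1 with x
  by_cases hx : x ∈ Ioo a b <;> simp [hx, hf]

lemma h_mul_h_of_notMem {T τ : ℝ} (hτ : τ ∉ Ioo 0 T) (a c μ ν : ℝ) :
    h (T - τ) a μ * h τ c ν = 0 := by
  rcases le_or_gt τ 0 with h0 | h0
  · rw [h_of_nonpos h0, mul_zero]
  · have : T ≤ τ := not_lt.1 fun hT => hτ ⟨h0, hT⟩
    rw [h_of_nonpos (sub_nonpos.2 this), zero_mul]

/-- Convolution identity for hitting time densities without drift. -/
lemma lintegral_h_mul_h_zero (T : ℝ) {a c : ℝ} (ha : 0 < a) (hc : 0 < c) :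
    ∫⁻ τ, ENNReal.ofReal (h (T - τ) a 0 * h τ c 0) = ENNReal.ofReal (h T (a + c) 0) := by
  rw [lintegral_eq_setLIntegral_Ioo (a := 0) (b := T)
    fun τ hτ => by rw [h_mul_h_of_notMem hτ, ENNReal.ofReal_zero]]
  rcases le_or_gt T 0 with hT | hT
  · simp [h_of_nonpos hT, Ioo_eq_empty_of_le hT]
  · rw [lintegral_deriv_of_nonneg_of_tendsto hT
      (fun s hs => hasDerivAt_convPrimitive hs.1 hs.2 ha hc)
      (fun s _ => mul_nonneg (h_nonneg _ _ _) (h_nonneg _ _ _))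
      (tendsto_convPrimitive_zero hT hc) (tendsto_convPrimitive_right hT ha)]
    congr 1
    rw [h_zero_of_pos hT (add_pos ha hc)]
    have e : √(2 * π) ^ 2 = 2 * π := Real.sq_sqrt (by positivity)
    have q1 : 0 < √(2 * π) := by positivity
    have q2 : 0 < √T := Real.sqrt_pos.2 hT
    generalize √(2 * π) = g at *
    rw [← e]
    field_simp
    ring

/-- Semigroup property of hitting time densities in the distance variable. -/
lemma lintegral_h_mul_h (T μ : ℝ) {a c : ℝ} (ha : 0 < a) (hc : 0 < c) :
    ∫⁻ τ, ENNReal.ofReal (h (T - τ) a μ * h τ c μ) = ENNReal.ofReal (h T (a + c) μ) := by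
  rw [h_eq_exp_mul T (a + c) μ, ENNReal.ofReal_mul (exp_pos _).le,
    ← lintegral_h_mul_h_zero T ha hc, ← lintegral_const_mul' _ _ ENNReal.ofReal_ne_top]
  congr 1 with τ
  rw [← ENNReal.ofReal_mul (exp_pos _).le, h_eq_exp_mul (T - τ) a μ, h_eq_exp_mul τ c μ]
  congr 1
  rw [mul_mul_mul_comm, ← Real.exp_add]
  congr 2
  ring

/-- Bound for the convolution of two hitting time densities with different drifts. -/
lemma lintegral_h_mul_h_le (T μ ν : ℝ) {a c : ℝ} (ha : 0 < a) (hc : 0 < c) :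
    ∫⁻ τ, ENNReal.ofReal (h (T - τ) a μ * h τ c ν)
      ≤ ENNReal.ofReal (exp (-a * μ - c * ν) * h T (a + c) 0) := by
  rw [ENNReal.ofReal_mul (exp_pos _).le,
    ← lintegral_h_mul_h_zero T ha hc, ← lintegral_const_mul' _ _ ENNReal.ofReal_ne_top]
  refine lintegral_mono fun τ => ?_
  rw [← ENNReal.ofReal_mul (exp_pos _).le]
  refine ENNReal.ofReal_le_ofReal ?_
  by_cases hτ : τ ∈ Ioo 0 T
  · rw [h_eq_exp_mul (T - τ) a μ, h_eq_exp_mul τ c ν, mul_mul_mul_comm, ← Real.exp_add]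
    refine mul_le_mul_of_nonneg_right (Real.exp_le_exp.2 ?_)
      (mul_nonneg (h_nonneg _ _ _) (h_nonneg _ _ _))
    have h1 := mul_nonneg (sq_nonneg μ) (sub_pos.2 hτ.2).le
    have h2 := mul_nonneg (sq_nonneg ν) hτ.1.le
    linarith
  · rw [h_mul_h_of_notMem hτ, h_mul_h_of_notMem hτ, mul_zero]

lemma integrable_h (t μ : ℝ) : Integrable fun x => h t x μ := by
  rcases le_or_gt t 0 with ht | ht
  · simp [h_of_nonpos ht]
  have hb : 0 < 1 / (2 * t) := by positivity
  have h1 := ((integrable_mul_exp_neg_mul_sq hb).norm.add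
    ((integrable_exp_neg_mul_sq hb).const_mul |μ * t|)).comp_add_right (μ * t)
  refine (h1.const_mul (√(2 * π * t ^ 3))⁻¹).mono'
    (Measurable.h_comp measurable_const measurable_id μ).aestronglyMeasurable
    (Eventually.of_forall fun x => ?_)
  rw [Real.norm_of_nonneg (h_nonneg _ _ _)]
  simp only [Pi.add_apply, norm_mul, Real.norm_eq_abs, abs_exp, ← add_mul]
  have hx : |x| ≤ |x + μ * t| + |μ * t| := by
    simpa using abs_sub (x + μ * t) (μ * t)
  unfold h
  rw [div_eq_inv_mul, mul_assoc]
  gcongr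
  apply le_of_eq
  ring

/-- The mass in `b` of the convolutions defining `fplus` is finite. -/
lemma lintegral_lintegral_h_mul_h_lt_top {β y : ℝ} (hβ : β ∈ Ioo (-1 : ℝ) 1) (hy : 0 < y)
    (T μ ν : ℝ) :
    ∫⁻ b in Ioi (0 : ℝ), ∫⁻ τ,
      ENNReal.ofReal (h (T - τ) ((1 + β) * b + y) μ * h τ ((1 - β) * b) ν) < ⊤ := by
  set k : ℝ := ((1 + β) * μ + (1 - β) * ν) / 2
  have hi : Integrable fun b : ℝ =>
      exp (k * y - y * μ + k ^ 2 * T / 2) * h T (2 * b + y) k := by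
    refine Integrable.const_mul ?_ _
    exact ((integrable_h T k).comp_add_right y).comp_mul_left' two_ne_zero
  refine lt_of_le_of_lt (setLIntegral_mono' measurableSet_Ioi fun b hb => ?_)
    hi.integrableOn.lintegral_lt_top
  have hb : 0 < b := hb
  have h1 : 0 < 1 + β := by linarith [hβ.1]
  have h2 : 0 < 1 - β := by linarith [hβ.2]
  refine (lintegral_h_mul_h_le T μ ν (by positivity) (by positivity)).trans
    (ENNReal.ofReal_le_ofReal (le_of_eq ?_))
  rw [h_eq_exp_mul T _ k, ← mul_assoc, ← Real.exp_add,
    show (1 + β) * b + y + (1 - β) * b = 2 * b + y by ring]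
  congr 2
  simp only [k]
  ring

/-- The double integral defining `fplus` as a lower Lebesgue integral. -/
lemma integral_intervalIntegral_h_mul_h {β y s : ℝ} (hβ : β ∈ Ioo (-1 : ℝ) 1) (hy : 0 < y)
    (hs : 0 ≤ s) (μ ν : ℝ) :
    ∫ b in Ioi (0 : ℝ), ∫ τ in (0 : ℝ)..s,
        h (s - τ) ((1 + β) * b + y) μ * h τ ((1 - β) * b) ν
      = (∫⁻ b in Ioi (0 : ℝ), ∫⁻ τ, ENNReal.ofReal
        (h (s - τ) ((1 + β) * b + y) μ * h τ ((1 - β) * b) ν)).toReal := by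
  have hmeas : Measurable (Function.uncurry fun b τ : ℝ => ENNReal.ofReal
      (h (s - τ) ((1 + β) * b + y) μ * h τ ((1 - β) * b) ν)) := by
    refine ((Measurable.h_comp ?_ ?_ μ).mul (Measurable.h_comp ?_ ?_ ν)).ennreal_ofReal <;>
    fun_prop
  have hfin := lintegral_lintegral_h_mul_h_lt_top hβ hy s μ ν
  have hinner : Measurable fun b => ∫⁻ τ, ENNReal.ofReal
      (h (s - τ) ((1 + β) * b + y) μ * h τ ((1 - β) * b) ν) := hmeas.lintegral_prod_right'
  rw [← integral_toReal hinner.aemeasurable (ae_lt_top hinner hfin.ne)]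
  congr 1 with b
  rw [intervalIntegral.integral_of_le hs, integral_Ioc_eq_integral_Ioo,
    integral_eq_lintegral_of_nonneg_ae
      (Eventually.of_forall fun τ => mul_nonneg (h_nonneg _ _ _) (h_nonneg _ _ _)),
    lintegral_eq_setLIntegral_Ioo (a := 0) (b := s)
      fun τ hτ => by rw [h_mul_h_of_notMem hτ, ENNReal.ofReal_zero]]
  · refine Measurable.aestronglyMeasurable
      ((Measurable.h_comp ?_ ?_ μ).mul (Measurable.h_comp ?_ ?_ ν)) <;> fun_prop

/-- Tonelli form of the convolution identity. -/
lemma lintegral_conv_h {A B x : ℝ} (hA : 0 < A) (hx : 0 < x) (t μ ν : ℝ) :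
    ∫⁻ η, (∫⁻ τ, ENNReal.ofReal (h (η - τ) A μ * h τ B ν)) * ENNReal.ofReal (h (t - η) x μ)
      = ∫⁻ τ, ENNReal.ofReal (h (t - τ) (x + A) μ * h τ B ν) := by
  simp_rw [← lintegral_mul_const' _ _ ENNReal.ofReal_ne_top]
  rw [lintegral_lintegral_swap]
  · congr 1 with τ
    rw [ENNReal.ofReal_mul (h_nonneg _ _ _), ← lintegral_h_mul_h (t - τ) μ hx hA,
      ← lintegral_mul_const' _ _ ENNReal.ofReal_ne_top,
      ← lintegral_sub_right_eq_self (fun η => ENNReal.ofReal (h (t - τ - η) x μ * h η A μ) * _) τ]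
    congr 1 with η
    rw [← ENNReal.ofReal_mul (mul_nonneg (h_nonneg _ _ _) (h_nonneg _ _ _)),
      ← ENNReal.ofReal_mul (mul_nonneg (h_nonneg _ _ _) (h_nonneg _ _ _)),
      show t - τ - (η - τ) = t - η by ring]
    congr 1
    ring
  · refine Measurable.aemeasurable (Measurable.mul
      ((Measurable.h_comp ?_ ?_ μ).mul (Measurable.h_comp ?_ ?_ ν)).ennreal_ofReal
      (Measurable.h_comp ?_ ?_ μ).ennreal_ofReal) <;> fun_prop

/-- Convolution identity used for the transition density with start `x > 0`, `y > 0`. -/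
theorem fplus_convolution_pos (β μp μm t x y : ℝ)
    (hβ : β ∈ Ioo (-1 : ℝ) 1) (ht : 0 < t) (hx : 0 < x) (hy : 0 < y) :
    ∫ η in (0 : ℝ)..t, fplus β μp μm η y * h (t - η) x μp
      = ∫ b in Ioi (0 : ℝ), ∫ τ in (0 : ℝ)..t,
          h (t - τ) ((1 + β) * b + x + y) μp * h τ ((1 - β) * b) (-μm) := by
  have hM (η : ℝ) := lintegral_lintegral_h_mul_h_lt_top hβ hy η μp (-μm)
  have hmeas : Measurable (Function.uncurry fun (p : ℝ × ℝ) τ => ENNReal.ofReal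
      (h (p.1 - τ) ((1 + β) * p.2 + y) μp * h τ ((1 - β) * p.2) (-μm))) := by
    refine ((Measurable.h_comp ?_ ?_ μp).mul (Measurable.h_comp ?_ ?_ (-μm))).ennreal_ofReal <;>
    fun_prop
  have hmeasx : Measurable fun η => ENNReal.ofReal (h (t - η) x μp) :=
    (Measurable.h_comp (by fun_prop) (by fun_prop) μp).ennreal_ofReal
  set L : ℝ → ℝ → ENNReal := fun η b => ∫⁻ τ, ENNReal.ofReal
    (h (η - τ) ((1 + β) * b + y) μp * h τ ((1 - β) * b) (-μm)) with hL
  have hmeasL : Measurable (Function.uncurry L) := hmeas.lintegral_prod_right'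
  have hmeasM : Measurable fun η => ∫⁻ b in Ioi (0 : ℝ), L η b := hmeasL.lintegral_prod_right'
  have hLzero : ∀ η ≤ 0, ∀ b, L η b = 0 := fun η hη b => by
    simp only [hL]
    rw [lintegral_eq_setLIntegral_Ioo (a := 0) (b := η)
      fun τ hτ => by rw [h_mul_h_of_notMem hτ, ENNReal.ofReal_zero]]
    simp [Ioo_eq_empty_of_le hη]
  have hadd (b : ℝ) : (1 + β) * b + x + y = (1 + β) * b + (x + y) := add_assoc _ _ _
  simp_rw [hadd]
  rw [integral_intervalIntegral_h_mul_h hβ (add_pos hx hy) ht.le,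
    intervalIntegral.integral_of_le ht.le, integral_Ioc_eq_integral_Ioo]
  have hleft : ∀ η ∈ Ioo 0 t, fplus β μp μm η y * h (t - η) x μp
      = ((∫⁻ b in Ioi (0 : ℝ), L η b) * ENNReal.ofReal (h (t - η) x μp)).toReal := by
    intro η hη
    rw [ENNReal.toReal_mul, ENNReal.toReal_ofReal (h_nonneg _ _ _), fplus,
      integral_intervalIntegral_h_mul_h hβ hy hη.1.le]
  have hprod : Measurable fun η =>
      (∫⁻ b in Ioi (0 : ℝ), L η b) * ENNReal.ofReal (h (t - η) x μp) := hmeasM.mul hmeasx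
  rw [setIntegral_congr_fun measurableSet_Ioo hleft, integral_toReal hprod.aemeasurable
    (Eventually.of_forall fun η => ENNReal.mul_lt_top (hM η) ENNReal.ofReal_lt_top)]
  congr 1
  rw [← lintegral_eq_setLIntegral_Ioo]
  · simp_rw [← lintegral_mul_const' _ _ ENNReal.ofReal_ne_top]
    rw [lintegral_lintegral_swap (hmeasL.mul (hmeasx.comp measurable_fst)).aemeasurable]
    refine setLIntegral_congr_fun measurableSet_Ioi fun b hb => ?_
    have hA : 0 < (1 + β) * b + y :=
      add_pos (mul_pos (by linarith [hβ.1]) hb) hy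
    have := lintegral_conv_h (B := (1 - β) * b) hA hx t μp (-μm)
    rw [show x + ((1 + β) * b + y) = (1 + β) * b + (x + y) by ring] at this
    exact this
  · intro η hη
    rcases le_or_gt η 0 with h0 | h0
    · simp [hLzero η h0]
    · have : t ≤ η := not_lt.1 fun hT => hη ⟨h0, hT⟩
      simp [h_of_nonpos (sub_nonpos.2 this)]
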